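/- arXiv:1909.06082 — 2 statements merged into one kernel-verified Lean document; each statement's English description precedes it below -/
import Mathlib

section
/- Let Ω₁, Ω₂ ⊂ ℝⁿ be bounded measurable sets and let Φ be a Young's function, finite on [0,∞), satisfying Φ(xy) ≤ C₁·x·Φ(y) + C₂·Φ(x)·y for all x, y ≥ 0 and some constants C₁, C₂ ≥ 0, as well as Φ(t)/t → ∞ as t → ∞. If μ₁ ∈ L^Φ(Ω₁) and μ₂ ∈ L^Φ(Ω₂), then the product function π(x₁,x₂) := μ₁(x₁)·μ₂(x₂) belongs to L^Φ(Ω₁ × Ω₂). -/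
open MeasureTheory Set ENNReal NNReal Filter

/-- A Young's function: `Φ t = ∫₀ᵗ φ(s) ds` for an increasing, lower semicontinuous
`φ : [0,∞) → [0,∞]` with `φ 0 = 0` that is neither identically zero nor identically
infinite on `(0,∞)`. -/
def IsYoungFunction (Φ : ℝ → ℝ≥0∞) : Prop :=
  ∃ φ : ℝ → ℝ≥0∞,
    MonotoneOn φ (Ici 0) ∧
    LowerSemicontinuousOn φ (Ici 0) ∧
    φ 0 = 0 ∧
    (∃ t > (0 : ℝ), φ t ≠ 0) ∧
    (∃ t > (0 : ℝ), φ t ≠ ⊤) ∧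
    ∀ t ≥ (0 : ℝ), Φ t = ∫⁻ s in Ioc (0 : ℝ) t, φ s

/-- Membership in the Orlicz space `L^Φ(Ω)`: `f` is measurable with finite Luxemburg norm. -/
def MemOrlicz {α : Type*} [MeasureSpace α] (Φ : ℝ → ℝ≥0∞) (Ω : Set α) (f : α → ℝ) : Prop :=
  Measurable f ∧ ∃ lam > (0 : ℝ), ∫⁻ x in Ω, Φ (|f x| / lam) ≤ 1

theorem IsYoungFunction.monotoneOn {Φ : ℝ → ℝ≥0∞} (hΦ : IsYoungFunction Φ) :
    MonotoneOn Φ (Ici 0) := by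
  obtain ⟨φ, -, -, -, -, -, hint⟩ := hΦ
  intro s hs t ht hst
  rw [hint s hs, hint t ht]
  exact lintegral_mono_set (Ioc_subset_Ioc_right hst)

/-- Convexity of a Young's function along a ray through the origin. -/
theorem IsYoungFunction.mul_apply_div_le {Φ : ℝ → ℝ≥0∞} (hΦ : IsYoungFunction Φ)
    (N : ℕ) {x : ℝ} (hx : 0 ≤ x) :
    ((N : ℝ≥0∞) + 1) * Φ (x / (N + 1)) ≤ Φ x := by
  obtain ⟨φ, hmono, -, -, -, -, hint⟩ := hΦ
  have hN : (0 : ℝ) < N + 1 := by positivity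
  set a := x / (N + 1) with ha
  have ha0 : 0 ≤ a := by positivity
  have hxa : x = (N + 1) * a := by rw [ha]; field_simp
  have hax : a ≤ x := by
    rw [hxa]
    nlinarith [mul_nonneg (Nat.cast_nonneg (α := ℝ) N) ha0]
  have hsplit : Φ x = Φ a + ∫⁻ s in Ioc a x, φ s := by
    rw [hint x hx, hint a ha0, ← Ioc_union_Ioc_eq_Ioc ha0 hax,
      lintegral_union measurableSet_Ioc (Ioc_disjoint_Ioc_of_le le_rfl)]
  have hle : Φ a ≤ φ a * ENNReal.ofReal a := by
    rw [hint a ha0]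
    calc ∫⁻ s in Ioc 0 a, φ s ≤ ∫⁻ _ in Ioc 0 a, φ a :=
          setLIntegral_mono' measurableSet_Ioc fun s hs => hmono hs.1.le ha0 hs.2
      _ = φ a * ENNReal.ofReal a := by simp
  have hge : φ a * ENNReal.ofReal (x - a) ≤ ∫⁻ s in Ioc a x, φ s := by
    calc φ a * ENNReal.ofReal (x - a) = ∫⁻ _ in Ioc a x, φ a := by simp
      _ ≤ ∫⁻ s in Ioc a x, φ s :=
          setLIntegral_mono' measurableSet_Ioc fun s hs => hmono ha0 (ha0.trans hs.1.le) hs.1.le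
  have hxsub : ENNReal.ofReal (x - a) = N * ENNReal.ofReal a := by
    rw [show x - a = N * a by rw [hxa]; ring, ENNReal.ofReal_mul (Nat.cast_nonneg N),
      ENNReal.ofReal_natCast]
  calc ((N : ℝ≥0∞) + 1) * Φ a = Φ a + N * Φ a := by ring
    _ ≤ Φ a + N * (φ a * ENNReal.ofReal a) := by gcongr
    _ = Φ a + φ a * ENNReal.ofReal (x - a) := by rw [hxsub]; ring
    _ ≤ Φ x := by rw [hsplit]; gcongr

theorem IsYoungFunction.measurable_comp {Φ : ℝ → ℝ≥0∞} (hΦ : IsYoungFunction Φ)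
    {α : Type*} [MeasurableSpace α] {f : α → ℝ} (hf : Measurable f) (hf0 : ∀ x, 0 ≤ f x) :
    Measurable fun x => Φ (f x) := by
  have hmono : Monotone fun t : ℝ => Φ (max t 0) := fun s t hst =>
    hΦ.monotoneOn (le_max_right s 0) (le_max_right t 0) (max_le_max_right 0 hst)
  convert hmono.measurable.comp hf using 2 with x
  simp [max_eq_left (hf0 x)]

/-- A superlinear function dominates the identity up to a constant. -/
theorem exists_ofReal_le_add_of_tendsto_div {Φ : ℝ → ℝ≥0∞}
    (hsup : Tendsto (fun t : ℝ => Φ t / ENNReal.ofReal t) atTop (nhds ⊤)) :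
    ∃ T : ℝ, ∀ t, ENNReal.ofReal t ≤ ENNReal.ofReal T + Φ t := by
  obtain ⟨T, hT⟩ := eventually_atTop.1 (hsup.eventually (lt_mem_nhds ENNReal.one_lt_top))
  refine ⟨T, fun t => ?_⟩
  rcases le_total t T with h | h
  · exact (ENNReal.ofReal_le_ofReal h).trans le_self_add
  · have := ENNReal.mul_le_of_le_div (hT t h).le
    rw [one_mul] at this
    exact this.trans le_add_self

/-- On sets of finite measure, a nonnegative function with finite modular for a superlinear `Φ`
is integrable. -/
theorem setLIntegral_ofReal_ne_top_of_tendsto_div {Φ : ℝ → ℝ≥0∞}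
    (hsup : Tendsto (fun t : ℝ => Φ t / ENNReal.ofReal t) atTop (nhds ⊤))
    {α : Type*} [MeasurableSpace α] {μ : Measure α} {s : Set α} (hs : μ s ≠ ⊤) {f : α → ℝ}
    (hf : ∫⁻ x in s, Φ (f x) ∂μ ≠ ⊤) :
    ∫⁻ x in s, ENNReal.ofReal (f x) ∂μ ≠ ⊤ := by
  obtain ⟨T, hT⟩ := exists_ofReal_le_add_of_tendsto_div hsup
  refine ne_top_of_le_ne_top ?_ (lintegral_mono fun x => hT (f x))
  rw [lintegral_add_left measurable_const]
  simp only [lintegral_const, Measure.restrict_apply_univ]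
  exact ENNReal.add_ne_top.2 ⟨ENNReal.mul_ne_top ENNReal.ofReal_ne_top hs, hf⟩

/-- If `Φ` is a finite Young's function with `Φ(xy) ≤ C₁ x Φ(y) + C₂ Φ(x) y` and
`Φ(t)/t → ∞` as `t → ∞`, and `μᵢ ∈ L^Φ(Ωᵢ)`, then the product function
`π(x₁,x₂) = μ₁(x₁) μ₂(x₂)` belongs to `L^Φ(Ω₁ × Ω₂)`. -/
theorem product_mem_orlicz' {n : ℕ} (Φ : ℝ → ℝ≥0∞) (hΦ : IsYoungFunction Φ)
    (hfin : ∀ t ≥ (0 : ℝ), Φ t ≠ ⊤)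
    (Ω₁ Ω₂ : Set (Fin n → ℝ))
    (hΩ₁m : MeasurableSet Ω₁) (hΩ₂m : MeasurableSet Ω₂)
    (hΩ₁b : Bornology.IsBounded Ω₁) (hΩ₂b : Bornology.IsBounded Ω₂)
    (C₁ C₂ : ℝ≥0)
    (hmul : ∀ x ≥ (0 : ℝ), ∀ y ≥ (0 : ℝ),
      Φ (x * y) ≤ C₁ * ENNReal.ofReal x * Φ y + C₂ * Φ x * ENNReal.ofReal y)
    (hsup : Tendsto (fun t : ℝ => Φ t / ENNReal.ofReal t) atTop (nhds ⊤))
    (μ₁ μ₂ : (Fin n → ℝ) → ℝ)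
    (hμ₁ : MemOrlicz Φ Ω₁ μ₁) (hμ₂ : MemOrlicz Φ Ω₂ μ₂) :
    MemOrlicz Φ (Ω₁ ×ˢ Ω₂) (fun x => μ₁ x.1 * μ₂ x.2) := by
  obtain ⟨hm₁, l₁, hl₁, hI₁⟩ := hμ₁
  obtain ⟨hm₂, l₂, hl₂, hI₂⟩ := hμ₂
  set f := fun x => |μ₁ x| / l₁ with hf
  set g := fun x => |μ₂ x| / l₂ with hg
  have hf0 : ∀ x, 0 ≤ f x := fun x => by positivity
  have hg0 : ∀ x, 0 ≤ g x := fun x => by positivity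
  have hfm : Measurable f := by fun_prop
  have hgm : Measurable g := by fun_prop
  have hΦf := hΦ.measurable_comp hfm hf0
  have hΦg := hΦ.measurable_comp hgm hg0
  have hΦf_top : ∫⁻ x in Ω₁, Φ (f x) ≠ ⊤ := ne_top_of_le_ne_top one_ne_top hI₁
  have hΦg_top : ∫⁻ x in Ω₂, Φ (g x) ≠ ⊤ := ne_top_of_le_ne_top one_ne_top hI₂
  have hf_top : ∫⁻ x in Ω₁, ENNReal.ofReal (f x) ≠ ⊤ :=
    setLIntegral_ofReal_ne_top_of_tendsto_div hsup hΩ₁b.measure_lt_top.ne hΦf_top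
  have hg_top : ∫⁻ x in Ω₂, ENNReal.ofReal (g x) ≠ ⊤ :=
    setLIntegral_ofReal_ne_top_of_tendsto_div hsup hΩ₂b.measure_lt_top.ne hΦg_top
  have hI : ∫⁻ p in Ω₁ ×ˢ Ω₂, Φ (f p.1 * g p.2) ≠ ⊤ := by
    refine ne_top_of_le_ne_top (b := C₁ * ((∫⁻ x in Ω₁, ENNReal.ofReal (f x)) *
      ∫⁻ y in Ω₂, Φ (g y)) + C₂ * ((∫⁻ x in Ω₁, Φ (f x)) *
      ∫⁻ y in Ω₂, ENNReal.ofReal (g y))) ?_ ?_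
    · exact ENNReal.add_ne_top.2
        ⟨ENNReal.mul_ne_top coe_ne_top (ENNReal.mul_ne_top hf_top hΦg_top),
          ENNReal.mul_ne_top coe_ne_top (ENNReal.mul_ne_top hΦf_top hg_top)⟩
    · have h₁ : Measurable fun p : (Fin n → ℝ) × (Fin n → ℝ) =>
          ENNReal.ofReal (f p.1) * Φ (g p.2) :=
        (hfm.ennreal_ofReal.comp measurable_fst).mul (hΦg.comp measurable_snd)
      have h₂ : Measurable fun p : (Fin n → ℝ) × (Fin n → ℝ) =>
          Φ (f p.1) * ENNReal.ofReal (g p.2) :=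
        (hΦf.comp measurable_fst).mul (hgm.ennreal_ofReal.comp measurable_snd)
      rw [Measure.volume_eq_prod, ← Measure.prod_restrict,
        ← lintegral_prod_mul hfm.ennreal_ofReal.aemeasurable hΦg.aemeasurable,
        ← lintegral_prod_mul hΦf.aemeasurable hgm.ennreal_ofReal.aemeasurable,
        ← lintegral_const_mul _ h₁, ← lintegral_const_mul _ h₂,
        ← lintegral_add_left (h₁.const_mul _)]
      refine lintegral_mono fun p => (hmul _ (hf0 p.1) _ (hg0 p.2)).trans_eq ?_
      simp only [mul_assoc]
  obtain ⟨N, hN⟩ := ENNReal.exists_nat_gt hI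
  refine ⟨by fun_prop, (N + 1) * (l₁ * l₂), by positivity, ?_⟩
  have hN0 : (N : ℝ≥0∞) + 1 ≠ 0 := by simp
  have hN_top : (N : ℝ≥0∞) + 1 ≠ ⊤ := by simp
  calc ∫⁻ p in Ω₁ ×ˢ Ω₂, Φ (|μ₁ p.1 * μ₂ p.2| / ((N + 1) * (l₁ * l₂)))
      ≤ ∫⁻ p in Ω₁ ×ˢ Ω₂, ((N : ℝ≥0∞) + 1)⁻¹ * Φ (f p.1 * g p.2) := by
        refine lintegral_mono fun p => ?_
        rw [← ENNReal.div_eq_inv_mul, ENNReal.le_div_iff_mul_le (.inl hN0) (.inl hN_top), mul_comm]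
        convert hΦ.mul_apply_div_le N (mul_nonneg (hf0 p.1) (hg0 p.2)) using 3
        simp only [hf, hg, abs_mul]
        field_simp
    _ = ((N : ℝ≥0∞) + 1)⁻¹ * ∫⁻ p in Ω₁ ×ˢ Ω₂, Φ (f p.1 * g p.2) :=
        lintegral_const_mul' _ _ (by simp)
    _ ≤ ((N : ℝ≥0∞) + 1)⁻¹ * (N + 1) := by
        gcongr
        exact hN.le.trans le_self_add
    _ = 1 := ENNReal.inv_mul_cancel hN0 hN_top
end

section
/- Existence for the entropically regularized primal problem: let Ω₁, Ω₂ ⊂ ℝⁿ be compact, Ω := Ω₁ × Ω₂, let μ₁, μ₂ be finite nonnegative Borel measures on Ω₁, Ω₂ with μ₁(Ω₁) = μ₂(Ω₂), let c : Ω → ℝ be continuous and γ > 0. Then the problem of minimizing ∫_Ω c·π dx + γ·∫_Ω π log π dx (with 0·log 0 := 0) over measurable π : Ω → [0,∞) such that the measure π dx has marginals μ₁ and μ₂ admits a minimizer with finite objective value if and only if μ₁ and μ₂ are absolutely continuous with respect to Lebesgue measure with densities σ₁, σ₂ satisfying ∫_{Ω₁} σ₁ log₊ σ₁ dx < ∞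 and ∫_{Ω₂} σ₂ log₊ σ₂ dx < ∞. In this case the minimizer π̄ satisfies ∫_Ω π̄ log₊ π̄ dx < ∞ and is unique, where log₊ t := max(log t, 0). -/
open MeasureTheory Set ENNReal NNReal

/-- A transport plan density `π` on `Ω₁ × Ω₂` is feasible for the marginals `μ₁, μ₂` if it is
measurable, nonnegative, and the measure `π dx` has marginals `μ₁` and `μ₂`. -/
def IsFeasiblePlan {n : ℕ} (Ω₁ Ω₂ : Set (Fin n → ℝ)) (μ₁ μ₂ : Measure (Fin n → ℝ))
    (π : (Fin n → ℝ) × (Fin n → ℝ) → ℝ) : Prop :=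
  Measurable π ∧ (∀ x, 0 ≤ π x) ∧
    Measure.map Prod.fst
      ((volume.restrict (Ω₁ ×ˢ Ω₂)).withDensity fun x => ENNReal.ofReal (π x)) = μ₁ ∧
    Measure.map Prod.snd
      ((volume.restrict (Ω₁ ×ˢ Ω₂)).withDensity fun x => ENNReal.ofReal (π x)) = μ₂

/-- The entropically regularized primal objective `∫_Ω c π dx + γ ∫_Ω π log π dx`
(with `0 log 0 := 0`), as an extended real number: the entropy integral is split into its
positive and negative parts (the negative part is always finite on a bounded domain). -/
noncomputable def primalValueEnt {n : ℕ} (Ω₁ Ω₂ : Set (Fin n → ℝ))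
    (c : (Fin n → ℝ) × (Fin n → ℝ) → ℝ) (γ : ℝ)
    (π : (Fin n → ℝ) × (Fin n → ℝ) → ℝ) : EReal :=
  ((∫ x in Ω₁ ×ˢ Ω₂, c x * π x : ℝ) : EReal) +
    (γ : ℝ) * ((∫⁻ x in Ω₁ ×ˢ Ω₂, ENNReal.ofReal (π x * Real.log (π x))).toEReal -
      (∫⁻ x in Ω₁ ×ˢ Ω₂, ENNReal.ofReal (-(π x * Real.log (π x)))).toEReal)

/-- `π` is a minimizer with finite value of the entropically regularized problem. -/
def IsEntMinimizer {n : ℕ} (Ω₁ Ω₂ : Set (Fin n → ℝ)) (μ₁ μ₂ : Measure (Fin n → ℝ))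
    (c : (Fin n → ℝ) × (Fin n → ℝ) → ℝ) (γ : ℝ)
    (π : (Fin n → ℝ) × (Fin n → ℝ) → ℝ) : Prop :=
  IsFeasiblePlan Ω₁ Ω₂ μ₁ μ₂ π ∧ primalValueEnt Ω₁ Ω₂ c γ π ≠ ⊤ ∧
    ∀ π', IsFeasiblePlan Ω₁ Ω₂ μ₁ μ₂ π' →
      primalValueEnt Ω₁ Ω₂ c γ π ≤ primalValueEnt Ω₁ Ω₂ c γ π'

/-- `μ` is absolutely continuous w.r.t. Lebesgue measure on `Ω` with density `σ`
satisfying `∫_Ω σ log₊ σ dx < ∞`, where `log₊ t = max (log t) 0`. -/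
def HasLLogLDensity {n : ℕ} (Ω : Set (Fin n → ℝ)) (μ : Measure (Fin n → ℝ)) : Prop :=
  ∃ σ : (Fin n → ℝ) → ℝ, Measurable σ ∧ (∀ x, 0 ≤ σ x) ∧
    μ = (volume.restrict Ω).withDensity (fun x => ENNReal.ofReal (σ x)) ∧
    ∫⁻ x in Ω, ENNReal.ofReal (σ x * max (Real.log (σ x)) 0) < ⊤

/-- Tangent-line bound for `t log t` with a Hellinger-type remainder. -/
lemma mul_log_tangent_bound {s m : ℝ} (hs : 0 ≤ s) (hm : 0 < m) :
    (√s - √m) ^ 2 ≤ s * Real.log s - s * Real.log m - s + m := by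
  rcases hs.eq_or_lt with rfl | hs
  · simp [Real.sq_sqrt hm.le]
  have a := Real.sqrt_pos.2 hs
  have b := Real.sqrt_pos.2 hm
  have h := Real.one_sub_inv_le_log_of_pos (div_pos a b)
  rw [Real.log_div a.ne' b.ne', Real.log_sqrt hs.le, Real.log_sqrt hm.le, inv_div] at h
  have e1 := Real.sq_sqrt hs.le
  have e2 := Real.sq_sqrt hm.le
  have h2 : s * (1 - √m / √s) = s - √s * √m := by
    rw [mul_sub, mul_one, mul_div_assoc', show s * √m / √s = √s * √m by
      rw [div_eq_iff a.ne']; linear_combination -√m * e1]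
  nlinarith [mul_le_mul_of_nonneg_left h hs.le]

lemma neg_one_le_mul_log {t : ℝ} (ht : 0 ≤ t) : -1 ≤ t * Real.log t := by
  have h := mul_log_tangent_bound ht one_pos
  rw [Real.log_one] at h
  nlinarith [sq_nonneg (√t - √1)]

/-- Quantitative midpoint convexity of `t log t`. -/
lemma mul_log_midpoint_gap {s t : ℝ} (hs : 0 ≤ s) (ht : 0 ≤ t) (l : ℝ) :
    2 * l * |s - t| ≤ s * Real.log s + t * Real.log t
      - 2 * ((s + t) / 2 * Real.log ((s + t) / 2)) + 4 * l ^ 2 * (s + t) := by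
  rcases (add_nonneg hs ht).eq_or_lt with h0 | h0
  · obtain rfl : s = 0 := by linarith
    obtain rfl : t = 0 := by linarith
    simp
  have hm : 0 < (s + t) / 2 := by linarith
  have key : ∀ r, 0 ≤ r → 2 * l * |r - (s + t) / 2| ≤
      (√r - √((s + t) / 2)) ^ 2 + 2 * l ^ 2 * (r + (s + t) / 2) := by
    intro r hr
    have e1 := Real.sq_sqrt hr
    have e2 := Real.sq_sqrt hm.le
    set a := √r
    set b := √((s + t) / 2)
    have hab : 0 ≤ a + b := add_nonneg (Real.sqrt_nonneg _) (Real.sqrt_nonneg _)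
    rw [← e1, ← e2, sq_sub_sq, abs_mul, abs_of_nonneg hab]
    nlinarith [sq_nonneg (|a - b| - l * (a + b)), sq_abs (a - b), mul_nonneg (sq_nonneg l)
      (sq_nonneg (a - b))]
  have k1 := key s hs
  have k2 := key t ht
  have t1 := mul_log_tangent_bound hs hm
  have t2 := mul_log_tangent_bound ht hm
  have a1 : |s - (s + t) / 2| = |s - t| / 2 := by
    rw [show s - (s + t) / 2 = (s - t) / 2 by ring, abs_div, abs_two]
  have a2 : |t - (s + t) / 2| = |s - t| / 2 := by
    rw [show t - (s + t) / 2 = -((s - t) / 2) by ring, abs_neg, abs_div, abs_two]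
  rw [a1] at k1
  rw [a2] at k2
  linarith

section EntropyFunctional

variable {α : Type*} [MeasurableSpace α] {ν : Measure α}

/-- The regularized cost `∫ c p dν + γ ∫ p log p dν` as a real number. -/
noncomputable def entropyCost (ν : Measure α) (c : α → ℝ) (γ : ℝ) (p : α → ℝ) : ℝ :=
  ∫ x, c x * p x ∂ν + γ * ∫ x, p x * Real.log (p x) ∂ν

lemma measurable_mul_log {p : α → ℝ} (hp : Measurable p) :
    Measurable fun x => p x * Real.log (p x) :=
  hp.mul (Real.measurable_log.comp hp)

lemma integrable_midpoint_mul_log [IsFiniteMeasure ν] {p q : α → ℝ}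
    (hp : Measurable p) (hq : Measurable q) (hp0 : ∀ x, 0 ≤ p x) (hq0 : ∀ x, 0 ≤ q x)
    (hpl : Integrable (fun x => p x * Real.log (p x)) ν)
    (hql : Integrable (fun x => q x * Real.log (q x)) ν) :
    Integrable (fun x => (p x + q x) / 2 * Real.log ((p x + q x) / 2)) ν := by
  refine ((hpl.norm.add hql.norm).add (integrable_const 1)).mono'
    (measurable_mul_log ((hp.add hq).div_const 2)).aestronglyMeasurable
    (Filter.Eventually.of_forall fun x => ?_)
  have h := mul_log_midpoint_gap (hp0 x) (hq0 x) 0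
  have h1 := neg_one_le_mul_log (t := (p x + q x) / 2) (by linarith [hp0 x, hq0 x])
  simp only [Pi.add_apply, Real.norm_eq_abs]
  rw [abs_le]
  constructor <;>
  linarith [le_abs_self (p x * Real.log (p x)), le_abs_self (q x * Real.log (q x)),
    abs_nonneg (p x * Real.log (p x)), abs_nonneg (q x * Real.log (q x))]

/-- Strong midpoint convexity of the regularized cost with respect to the `L¹` distance. -/
lemma entropyCost_midpoint_gap [IsFiniteMeasure ν] {c p q : α → ℝ} {C γ : ℝ} (hγ : 0 ≤ γ)
    (hc : AEStronglyMeasurable c ν) (hC : ∀ᵐ x ∂ν, ‖c x‖ ≤ C)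
    (hp : Measurable p) (hq : Measurable q) (hp0 : ∀ x, 0 ≤ p x) (hq0 : ∀ x, 0 ≤ q x)
    (hpi : Integrable p ν) (hqi : Integrable q ν)
    (hpl : Integrable (fun x => p x * Real.log (p x)) ν)
    (hql : Integrable (fun x => q x * Real.log (q x)) ν) (l : ℝ) :
    γ * (2 * l * ∫ x, |p x - q x| ∂ν) ≤ entropyCost ν c γ p + entropyCost ν c γ q
      - 2 * entropyCost ν c γ (fun x => (p x + q x) / 2)
      + γ * (4 * l ^ 2 * (∫ x, p x ∂ν + ∫ x, q x ∂ν)) := by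
  have hml := integrable_midpoint_mul_log hp hq hp0 hq0 hpl hql
  have hlin : 2 * ∫ x, c x * ((p x + q x) / 2) ∂ν =
      ∫ x, c x * p x ∂ν + ∫ x, c x * q x ∂ν := by
    rw [← integral_add (hpi.bdd_mul hc hC) (hqi.bdd_mul hc hC), ← integral_const_mul]
    congr 1 with x
    ring
  have hent : 2 * l * ∫ x, |p x - q x| ∂ν ≤ ∫ x, p x * Real.log (p x) ∂ν +
      ∫ x, q x * Real.log (q x) ∂ν -
      2 * ∫ x, (p x + q x) / 2 * Real.log ((p x + q x) / 2) ∂ν +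
      4 * l ^ 2 * (∫ x, p x ∂ν + ∫ x, q x ∂ν) := by
    have h := integral_mono ((hpi.sub hqi).abs.const_mul (2 * l))
      (((hpl.add hql).sub (hml.const_mul 2)).add ((hpi.add hqi).const_mul (4 * l ^ 2)))
      fun x => mul_log_midpoint_gap (hp0 x) (hq0 x) l
    rw [integral_add' ((hpl.add hql).sub (hml.const_mul 2)) ((hpi.add hqi).const_mul _),
      integral_sub' (hpl.add hql) (hml.const_mul 2), integral_add' hpl hql, integral_const_mul,
      integral_const_mul, integral_const_mul, integral_add' hpi hqi] at h
    exact h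
  unfold entropyCost
  nlinarith [mul_le_mul_of_nonneg_left hent hγ]

lemma entropyCost_lower_bound [IsFiniteMeasure ν] {c p : α → ℝ} {C γ : ℝ} (hγ : 0 ≤ γ)
    (hc : AEStronglyMeasurable c ν) (hC : ∀ᵐ x ∂ν, ‖c x‖ ≤ C) (hp0 : ∀ x, 0 ≤ p x)
    (hpi : Integrable p ν) (hpl : Integrable (fun x => p x * Real.log (p x)) ν) :
    -(C * ∫ x, p x ∂ν) - γ * ν.real univ ≤ entropyCost ν c γ p := by
  have h1 : -(C * ∫ x, p x ∂ν) ≤ ∫ x, c x * p x ∂ν := by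
    rw [← integral_const_mul, ← integral_neg]
    refine integral_mono_ae (hpi.const_mul C).neg (hpi.bdd_mul hc hC) ?_
    filter_upwards [hC] with x hx
    have := neg_le_of_abs_le hx
    nlinarith [hp0 x]
  have h2 : -ν.real univ ≤ ∫ x, p x * Real.log (p x) ∂ν := by
    have := integral_mono (integrable_const (-1)) hpl fun x => neg_one_le_mul_log (hp0 x)
    simpa using this
  unfold entropyCost
  nlinarith

/-- Lower semicontinuity of the regularized cost along `L¹`-convergent sequences. -/
lemma entropyCost_le_of_tendsto [IsFiniteMeasure ν] {c p : α → ℝ} {C γ I : ℝ} (hγ : 0 < γ)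
    (hc : AEStronglyMeasurable c ν) (hC : ∀ᵐ x ∂ν, ‖c x‖ ≤ C)
    {u : ℕ → α → ℝ} (hu : ∀ k, Measurable (u k)) (hu0 : ∀ k x, 0 ≤ u k x)
    (hui : ∀ k, Integrable (u k) ν)
    (hul : ∀ k, Integrable (fun x => u k x * Real.log (u k x)) ν)
    (hp : Measurable p) (hp0 : ∀ x, 0 ≤ p x) (hpi : Integrable p ν)
    (hlim : Filter.Tendsto (fun k => eLpNorm (u k - p) 1 ν) Filter.atTop (nhds 0))
    (hI : Filter.Tendsto (fun k => entropyCost ν c γ (u k)) Filter.atTop (nhds I)) :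
    Integrable (fun x => p x * Real.log (p x)) ν ∧ entropyCost ν c γ p ≤ I := by
  have hcost : Filter.Tendsto (fun k => ∫ x, c x * u k x ∂ν) Filter.atTop
      (nhds (∫ x, c x * p x ∂ν)) := by
    refine tendsto_integral_of_L1' _ (hpi.bdd_mul hc hC).aestronglyMeasurable
      (Filter.Eventually.of_forall fun k => (hui k).bdd_mul hc hC) ?_
    have hb : Filter.Tendsto (fun k => ENNReal.ofReal C * eLpNorm (u k - p) 1 ν) Filter.atTop
        (nhds 0) := by
      simpa using ENNReal.Tendsto.const_mul hlim (Or.inr ENNReal.ofReal_ne_top)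
    refine tendsto_of_tendsto_of_tendsto_of_le_of_le tendsto_const_nhds hb
      (fun _ => zero_le) fun k => ?_
    refine eLpNorm_le_mul_eLpNorm_of_ae_le_mul ?_ 1
    filter_upwards [hC] with x hx
    simp only [Pi.sub_apply, ← mul_sub, norm_mul]
    gcongr
  have hent : Filter.Tendsto (fun k => ∫ x, u k x * Real.log (u k x) ∂ν) Filter.atTop
      (nhds ((I - ∫ x, c x * p x ∂ν) / γ)) := by
    refine ((hI.sub hcost).div_const γ).congr fun k => ?_
    unfold entropyCost
    field_simp
    ring
  obtain ⟨ns, hns, hae⟩ := (tendstoInMeasure_of_tendsto_eLpNorm one_ne_zero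
    (fun k => (hui k).aestronglyMeasurable) hpi.aestronglyMeasurable hlim).exists_seq_tendsto_ae
  set L := (I - ∫ x, c x * p x ∂ν) / γ + ν.real univ with hL
  have hshift : ∀ k, ∫ x, (u k x * Real.log (u k x) + 1) ∂ν =
      ∫ x, u k x * Real.log (u k x) ∂ν + ν.real univ := fun k => by
    rw [integral_add (hul k) (integrable_const _)]
    simp
  have hnn : ∀ k x, 0 ≤ u k x * Real.log (u k x) + 1 := fun k x => by
    linarith [neg_one_le_mul_log (hu0 k x)]
  have hpn : ∀ x, 0 ≤ p x * Real.log (p x) + 1 := fun x => by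
    linarith [neg_one_le_mul_log (hp0 x)]
  have hLt : Filter.Tendsto (fun j => ∫ x, (u (ns j) x * Real.log (u (ns j) x) + 1) ∂ν)
      Filter.atTop (nhds L) := by
    simp only [hshift]
    exact (hent.comp hns.tendsto_atTop).add_const _
  have hL0 : 0 ≤ L := ge_of_tendsto' hLt fun j => integral_nonneg (hnn _)
  have fatou : ∫⁻ x, ENNReal.ofReal (p x * Real.log (p x) + 1) ∂ν ≤ ENNReal.ofReal L := by
    calc ∫⁻ x, ENNReal.ofReal (p x * Real.log (p x) + 1) ∂ν
        = ∫⁻ x, Filter.liminf (fun j => ENNReal.ofReal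
            (u (ns j) x * Real.log (u (ns j) x) + 1)) Filter.atTop ∂ν := by
          refine lintegral_congr_ae ?_
          filter_upwards [hae] with x hx
          refine (Filter.Tendsto.liminf_eq ?_).symm
          exact ENNReal.tendsto_ofReal
            (((Real.continuous_mul_log.tendsto _).comp hx).add_const 1)
      _ ≤ Filter.liminf (fun j => ∫⁻ x, ENNReal.ofReal
            (u (ns j) x * Real.log (u (ns j) x) + 1) ∂ν) Filter.atTop :=
          lintegral_liminf_le fun j =>
            ((measurable_mul_log (hu _)).add_const 1).ennreal_ofReal
      _ = ENNReal.ofReal L := by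
          refine Filter.Tendsto.liminf_eq ((ENNReal.tendsto_ofReal hLt).congr fun j => ?_)
          exact ofReal_integral_eq_lintegral_ofReal ((hul _).add (integrable_const 1))
            (Filter.Eventually.of_forall (hnn _))
  have hpl1 : Integrable (fun x => p x * Real.log (p x) + 1) ν :=
    ⟨((measurable_mul_log hp).add_const 1).aestronglyMeasurable,
      (hasFiniteIntegral_iff_ofReal (Filter.Eventually.of_forall hpn)).2
        (fatou.trans_lt ENNReal.ofReal_lt_top)⟩
  have hpl : Integrable (fun x => p x * Real.log (p x)) ν := by
    refine (hpl1.sub (integrable_const (1 : ℝ))).congr (Filter.Eventually.of_forall fun x => ?_)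
    simp
  refine ⟨hpl, ?_⟩
  rw [← ofReal_integral_eq_lintegral_ofReal hpl1 (Filter.Eventually.of_forall hpn),
    ENNReal.ofReal_le_ofReal_iff hL0, integral_add hpl (integrable_const _), hL] at fatou
  simp only [integral_const, smul_eq_mul, mul_one, add_le_add_iff_right, le_div_iff₀ hγ] at fatou
  unfold entropyCost
  linarith

/-- Existence of a minimizer of the regularized cost over a midpoint-convex, `L¹`-closed set of
densities of equal mass. -/
theorem exists_entropyCost_minimizer [IsFiniteMeasure ν] {c : α → ℝ} {C γ M : ℝ} (hγ : 0 < γ)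
    (hc : AEStronglyMeasurable c ν) (hC : ∀ᵐ x ∂ν, ‖c x‖ ≤ C) {K : Set (α → ℝ)}
    (hK : ∀ p ∈ K, Measurable p ∧ (∀ x, 0 ≤ p x) ∧ Integrable p ν ∧ ∫ x, p x ∂ν = M)
    (hmid : ∀ p ∈ K, ∀ q ∈ K, (fun x => (p x + q x) / 2) ∈ K)
    (hclosed : ∀ (u : ℕ → α → ℝ) (p : α → ℝ), (∀ k, u k ∈ K) → Measurable p →
      (∀ x, 0 ≤ p x) → Integrable p ν →
      Filter.Tendsto (fun k => eLpNorm (u k - p) 1 ν) Filter.atTop (nhds 0) → p ∈ K)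
    (hne : ∃ p ∈ K, Integrable (fun x => p x * Real.log (p x)) ν) :
    ∃ p ∈ K, Integrable (fun x => p x * Real.log (p x)) ν ∧
      ∀ q ∈ K, Integrable (fun x => q x * Real.log (q x)) ν →
        entropyCost ν c γ p ≤ entropyCost ν c γ q := by
  set S : Set ℝ := entropyCost ν c γ ''
    {p | p ∈ K ∧ Integrable (fun x => p x * Real.log (p x)) ν}
  have hSne : S.Nonempty := by
    obtain ⟨p, hp, hpl⟩ := hne
    exact ⟨_, p, ⟨hp, hpl⟩, rfl⟩
  have hSb : BddBelow S := by
    refine ⟨-(C * M) - γ * ν.real univ, ?_⟩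
    rintro _ ⟨p, ⟨hp, hpl⟩, rfl⟩
    obtain ⟨-, h0, hi, hM⟩ := hK p hp
    have := entropyCost_lower_bound hγ.le hc hC h0 hi hpl
    rwa [hM] at this
  have hM0 : 0 ≤ M := by
    obtain ⟨p, hp, -⟩ := hne
    obtain ⟨-, h0, -, hM⟩ := hK p hp
    exact hM ▸ integral_nonneg h0
  have hseq : ∀ k : ℕ, ∃ p, (p ∈ K ∧ Integrable (fun x => p x * Real.log (p x)) ν) ∧
      entropyCost ν c γ p < sInf S + γ * ((1 / 2) ^ k) ^ 2 := fun k => by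
    obtain ⟨_, ⟨p, hp, rfl⟩, h⟩ := exists_lt_of_csInf_lt hSne
      (lt_add_of_pos_right (sInf S) (show 0 < γ * ((1 / 2) ^ k) ^ 2 by positivity))
    exact ⟨p, hp, h⟩
  choose u hu hlt using hseq
  have hmin : ∀ p ∈ K, Integrable (fun x => p x * Real.log (p x)) ν →
      sInf S ≤ entropyCost ν c γ p := fun p hp hpl => csInf_le hSb ⟨p, ⟨hp, hpl⟩, rfl⟩
  have hI : Filter.Tendsto (fun k => entropyCost ν c γ (u k)) Filter.atTop (nhds (sInf S)) := by
    refine tendsto_of_tendsto_of_tendsto_of_le_of_le tendsto_const_nhds ?_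
      (fun k => hmin _ (hu k).1 (hu k).2) (fun k => (hlt k).le)
    have := ((tendsto_pow_atTop_nhds_zero_of_lt_one (r := (1 / 2 : ℝ)) (by norm_num)
      (by norm_num)).pow 2).const_mul γ |>.const_add (sInf S)
    simpa using this
  have hcau : ∀ N k m : ℕ, N ≤ k → N ≤ m →
      eLpNorm (u k - u m) 1 ν < ENNReal.ofReal ((1 / 2) ^ N * (2 + 4 * M)) := by
    intro N k m hk hm
    obtain ⟨k1, k2, k3, k4⟩ := hK _ (hu k).1
    obtain ⟨m1, m2, m3, m4⟩ := hK _ (hu m).1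
    have hgap := entropyCost_midpoint_gap hγ.le hc hC k1 m1 k2 m2 k3 m3 (hu k).2 (hu m).2
      ((1 / 2) ^ N)
    have hlow := hmin _ (hmid _ (hu k).1 _ (hu m).1)
      (integrable_midpoint_mul_log k1 m1 k2 m2 (hu k).2 (hu m).2)
    have hpow : ∀ j, N ≤ j → γ * ((1 / 2 : ℝ) ^ j) ^ 2 ≤ γ * ((1 / 2 : ℝ) ^ N) ^ 2 := by
      intro j hj
      have := pow_le_pow_of_le_one (show (0 : ℝ) ≤ 1 / 2 by norm_num) (by norm_num) hj
      gcongr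
    have hdelta : 0 < (1 / 2 : ℝ) ^ N := by positivity
    rw [k4, m4] at hgap
    set δ := (1 / 2 : ℝ) ^ N
    have hd : ∫ x, |u k x - u m x| ∂ν ≤ δ * (1 + 4 * M) := by
      refine le_of_mul_le_mul_left ?_ (show 0 < γ * (2 * δ) by positivity)
      nlinarith [hlt k, hlt m, hpow k hk, hpow m hm]
    rw [eLpNorm_one_eq_lintegral_enorm, ← ofReal_integral_norm_eq_lintegral_enorm (k3.sub m3)]
    simp only [Pi.sub_apply, Real.norm_eq_abs]
    rw [ENNReal.ofReal_lt_ofReal_iff (by positivity)]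
    nlinarith
  have hsum : ∑' N : ℕ, ENNReal.ofReal ((1 / 2) ^ N * (2 + 4 * M)) ≠ ⊤ := by
    rw [← ENNReal.ofReal_tsum_of_nonneg (fun N => by positivity)
      ((summable_geometric_of_lt_one (by norm_num) (by norm_num)).mul_right _)]
    exact ENNReal.ofReal_ne_top
  obtain ⟨f, hf, hflim⟩ := Lp.cauchy_complete_eLpNorm le_rfl
    (fun k => memLp_one_iff_integrable.2 (hK _ (hu k).1).2.2.1) hsum hcau
  obtain ⟨g, hg, hfg⟩ := hf.1
  have hgi : Integrable g ν := (memLp_one_iff_integrable.1 hf).congr hfg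
  have hp : Measurable fun x => max (g x) 0 := hg.measurable.max measurable_const
  have hpi : Integrable (fun x => max (g x) 0) ν := hgi.pos_part
  have hplim : Filter.Tendsto (fun k => eLpNorm (u k - fun x => max (g x) 0) 1 ν) Filter.atTop
      (nhds 0) := by
    refine tendsto_of_tendsto_of_tendsto_of_le_of_le tendsto_const_nhds hflim
      (fun _ => zero_le) fun k => eLpNorm_mono_ae ?_
    filter_upwards [hfg] with x hx
    have h0 := (hK _ (hu k).1).2.1 x
    simp only [Pi.sub_apply, Real.norm_eq_abs, hx]
    simpa [max_eq_left h0] using abs_max_sub_max_le_abs (u k x) (g x) 0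
  have hpK := hclosed u _ (fun k => (hu k).1) hp (fun x => le_max_right _ _) hpi hplim
  obtain ⟨hpl, hle⟩ := entropyCost_le_of_tendsto hγ hc hC (fun k => (hK _ (hu k).1).1)
    (fun k => (hK _ (hu k).1).2.1) (fun k => (hK _ (hu k).1).2.2.1) (fun k => (hu k).2) hp
    (fun x => le_max_right _ _) hpi hplim hI
  exact ⟨_, hpK, hpl, fun q hq hql => hle.trans (hmin q hq hql)⟩

/-- Minimizers of the regularized cost over a midpoint-convex set are unique. -/
theorem entropyCost_minimizer_unique [IsFiniteMeasure ν] {c p q : α → ℝ} {C γ : ℝ} (hγ : 0 < γ)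
    (hc : AEStronglyMeasurable c ν) (hC : ∀ᵐ x ∂ν, ‖c x‖ ≤ C)
    (hp : Measurable p) (hq : Measurable q) (hp0 : ∀ x, 0 ≤ p x) (hq0 : ∀ x, 0 ≤ q x)
    (hpi : Integrable p ν) (hqi : Integrable q ν)
    (hpl : Integrable (fun x => p x * Real.log (p x)) ν)
    (hql : Integrable (fun x => q x * Real.log (q x)) ν)
    (hpm : entropyCost ν c γ p ≤ entropyCost ν c γ (fun x => (p x + q x) / 2))
    (hqm : entropyCost ν c γ q ≤ entropyCost ν c γ (fun x => (p x + q x) / 2)) :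
    p =ᵐ[ν] q := by
  set D := ∫ x, |p x - q x| ∂ν with hD
  set T := ∫ x, p x ∂ν + ∫ x, q x ∂ν
  have hD0 : 0 ≤ D := integral_nonneg fun x => abs_nonneg _
  have hT0 : 0 ≤ T := add_nonneg (integral_nonneg hp0) (integral_nonneg hq0)
  have h : ∀ l : ℝ, 2 * l * D ≤ 4 * l ^ 2 * T := fun l => by
    have := entropyCost_midpoint_gap hγ.le hc hC hp hq hp0 hq0 hpi hqi hpl hql l
    exact le_of_mul_le_mul_left (by linarith) hγ
  have hz : D = 0 := by
    by_contra hne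
    have hpos := lt_of_le_of_ne hD0 (Ne.symm hne)
    have h1 := h (D / (4 * (T + 1)))
    have hT1 : 0 < T + 1 := by linarith
    have e1 : 2 * (D / (4 * (T + 1))) * D = D ^ 2 / (4 * (T + 1) ^ 2) * (2 * (T + 1)) := by
      field_simp
    have e2 : 4 * (D / (4 * (T + 1))) ^ 2 * T = D ^ 2 / (4 * (T + 1) ^ 2) * T := by
      field_simp
    rw [e1, e2] at h1
    have := le_of_mul_le_mul_left h1 (by positivity)
    linarith
  have hae := (integral_eq_zero_iff_of_nonneg (fun x => abs_nonneg _) (hpi.sub hqi).abs).1 hz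
  filter_upwards [hae] with x hx
  exact sub_eq_zero.1 (abs_eq_zero.1 hx)

end EntropyFunctional

section Marginals

variable {α β : Type*} [MeasurableSpace α] [MeasurableSpace β]

lemma map_withDensity_ofReal_eq_iff {ν : Measure α} {f : α → β} (hf : Measurable f)
    {p : α → ℝ} (hp : Measurable p) (hp0 : ∀ x, 0 ≤ p x) {μ : Measure β} [IsFiniteMeasure μ] :
    Measure.map f (ν.withDensity fun x => ENNReal.ofReal (p x)) = μ ↔
      Integrable p ν ∧ ∀ A, MeasurableSet A → ∫ x in f ⁻¹' A, p x ∂ν = μ.real A := by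
  have happ : ∀ A, MeasurableSet A →
      Measure.map f (ν.withDensity fun x => ENNReal.ofReal (p x)) A =
        ∫⁻ x in f ⁻¹' A, ENNReal.ofReal (p x) ∂ν := fun A hA => by
    rw [Measure.map_apply hf hA, withDensity_apply _ (hf hA)]
  constructor
  · rintro rfl
    have hpi : Integrable p ν := by
      refine ⟨hp.aestronglyMeasurable,
        (hasFiniteIntegral_iff_ofReal (Filter.Eventually.of_forall hp0)).2 ?_⟩
      have := happ univ MeasurableSet.univ
      rw [preimage_univ, Measure.restrict_univ] at this
      exact this ▸ measure_lt_top _ _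
    refine ⟨hpi, fun A hA => ?_⟩
    rw [Measure.real, happ A hA, integral_eq_lintegral_of_nonneg_ae
      (Filter.Eventually.of_forall hp0) hp.aestronglyMeasurable]
  · rintro ⟨hpi, h⟩
    ext A hA
    rw [happ A hA, ← ofReal_integral_eq_lintegral_ofReal hpi.integrableOn
      (Filter.Eventually.of_forall hp0), h A hA, ofReal_measureReal]

lemma map_fst_prod_withDensity {ν₁ : Measure α} {ν₂ : Measure β} [SFinite ν₁] [SFinite ν₂]
    {g : α × β → ℝ≥0∞} (hg : Measurable g) :
    Measure.map Prod.fst ((ν₁.prod ν₂).withDensity g) =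
      ν₁.withDensity fun x => ∫⁻ y, g (x, y) ∂ν₂ := by
  ext A hA
  rw [Measure.map_apply measurable_fst hA, withDensity_apply _ (measurable_fst hA),
    withDensity_apply _ hA, ← prod_univ, ← Measure.prod_restrict, Measure.restrict_univ,
    lintegral_prod _ hg.aemeasurable]

lemma map_snd_prod_withDensity {ν₁ : Measure α} {ν₂ : Measure β} [SFinite ν₁] [SFinite ν₂]
    {g : α × β → ℝ≥0∞} (hg : Measurable g) :
    Measure.map Prod.snd ((ν₁.prod ν₂).withDensity g) =
      ν₂.withDensity fun y => ∫⁻ x, g (x, y) ∂ν₁ := by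
  ext A hA
  rw [Measure.map_apply measurable_snd hA, withDensity_apply _ (measurable_snd hA),
    withDensity_apply _ hA, ← univ_prod, ← Measure.prod_restrict, Measure.restrict_univ,
    lintegral_prod_symm _ hg.aemeasurable]

end Marginals

lemma mul_posLog_le_add {s t : ℝ} (hs : 0 ≤ s) (ht : 0 ≤ t) :
    s * max (Real.log t) 0 ≤ s * max (Real.log s) 0 + t := by
  have h0 : 0 ≤ s * max (Real.log s) 0 := mul_nonneg hs (le_max_right _ _)
  rcases ht.eq_or_lt with rfl | ht
  · simpa using h0
  rcases max_cases (Real.log t) 0 with ⟨h, -⟩ | ⟨h, -⟩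
  · rw [h]
    have := mul_log_tangent_bound hs ht
    have h1 := mul_le_mul_of_nonneg_left (le_max_left (Real.log s) 0) hs
    nlinarith [sq_nonneg (√s - √t)]
  · rw [h]
    linarith

lemma ofReal_mul_posLog {t : ℝ} (ht : 0 ≤ t) :
    ENNReal.ofReal (t * max (Real.log t) 0) = ENNReal.ofReal (t * Real.log t) := by
  rw [mul_max_of_nonneg _ _ ht, mul_zero, ENNReal.ofReal_max, ENNReal.ofReal_zero, max_eq_left
    zero_le]

/-- A marginal of a density of finite entropy has an `L log L` density. -/
lemma hasLLogLDensity_of_marginal {n : ℕ} {β : Type*} [MeasurableSpace β]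
    {Ω : Set (Fin n → ℝ)} {ν : Measure β} [IsFiniteMeasure ν] {μ : Measure (Fin n → ℝ)}
    [IsFiniteMeasure μ] {p : (Fin n → ℝ) → β → ℝ} (hp : Measurable (Function.uncurry p))
    (hp0 : ∀ x y, 0 ≤ p x y)
    (hμ : (volume.restrict Ω).withDensity (fun x => ∫⁻ y, ENNReal.ofReal (p x y) ∂ν) = μ)
    (hent : ∫⁻ x in Ω, ∫⁻ y, ENNReal.ofReal (p x y * Real.log (p x y)) ∂ν < ⊤) :
    HasLLogLDensity Ω μ := by
  set G : (Fin n → ℝ) → ℝ≥0∞ := fun x => ∫⁻ y, ENNReal.ofReal (p x y) ∂ν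
  have hGm : Measurable G := hp.ennreal_ofReal.lintegral_prod_right'
  have hGfin : ∫⁻ x in Ω, G x < ⊤ := by
    have := measure_lt_top μ univ
    rwa [← hμ, withDensity_apply _ MeasurableSet.univ, Measure.restrict_univ] at this
  have hGae : ∀ᵐ x ∂volume.restrict Ω, G x < ⊤ := ae_lt_top hGm hGfin.ne
  refine ⟨fun x => (G x).toReal, hGm.ennreal_toReal, fun x => ENNReal.toReal_nonneg, ?_, ?_⟩
  · rw [← hμ]
    refine withDensity_congr_ae ?_
    filter_upwards [hGae] with x hx
    rw [ENNReal.ofReal_toReal hx.ne]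
  · have hle : ∀ᵐ x ∂volume.restrict Ω,
        ENNReal.ofReal ((G x).toReal * max (Real.log (G x).toReal) 0) ≤
          (∫⁻ y, ENNReal.ofReal (p x y * Real.log (p x y)) ∂ν) + G x * ν univ := by
      filter_upwards [hGae] with x hx
      have hpx : Measurable (p x) := hp.comp measurable_prodMk_left
      calc ENNReal.ofReal ((G x).toReal * max (Real.log (G x).toReal) 0)
          = ∫⁻ y, ENNReal.ofReal (p x y * max (Real.log (G x).toReal) 0) ∂ν := by
            simp only [ENNReal.ofReal_mul ENNReal.toReal_nonneg, ENNReal.ofReal_mul (hp0 _ _)]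
            rw [lintegral_mul_const _ hpx.ennreal_ofReal, ENNReal.ofReal_toReal hx.ne]
        _ ≤ ∫⁻ y, (ENNReal.ofReal (p x y * Real.log (p x y)) + G x) ∂ν := by
            refine lintegral_mono fun y => ?_
            refine (ENNReal.ofReal_le_ofReal
              (mul_posLog_le_add (hp0 x y) ENNReal.toReal_nonneg)).trans ?_
            refine ENNReal.ofReal_add_le.trans ?_
            rw [ofReal_mul_posLog (hp0 x y), ENNReal.ofReal_toReal hx.ne]
        _ = _ := by
            rw [lintegral_add_right _ measurable_const, lintegral_const]
    refine (lintegral_mono_ae hle).trans_lt ?_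
    rw [lintegral_add_right _ (hGm.mul_const _), lintegral_mul_const _ hGm]
    exact ENNReal.add_lt_top.2 ⟨hent, ENNReal.mul_lt_top hGfin (measure_lt_top _ _)⟩

lemma integrable_mul_posLog {α : Type*} [MeasurableSpace α] {ν : Measure α} {s : α → ℝ}
    (hs : Measurable s) (hs0 : ∀ x, 0 ≤ s x)
    (h : ∫⁻ x, ENNReal.ofReal (s x * max (Real.log (s x)) 0) ∂ν < ⊤) :
    Integrable (fun x => s x * max (Real.log (s x)) 0) ν :=
  ⟨(hs.mul ((Real.measurable_log.comp hs).max measurable_const)).aestronglyMeasurable,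
    (hasFiniteIntegral_iff_ofReal (Filter.Eventually.of_forall fun x =>
      mul_nonneg (hs0 x) (le_max_right _ _))).2 h⟩

/-- The normalized product of two `L log L` densities has finite entropy. -/
lemma integrable_prod_mul_log {α β : Type*} [MeasurableSpace α] [MeasurableSpace β]
    {ν₁ : Measure α} {ν₂ : Measure β} [IsFiniteMeasure ν₁] [IsFiniteMeasure ν₂]
    {s : α → ℝ} {t : β → ℝ} (hs : Measurable s) (ht : Measurable t)
    (hs0 : ∀ x, 0 ≤ s x) (ht0 : ∀ y, 0 ≤ t y) (hsi : Integrable s ν₁) (hti : Integrable t ν₂)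
    (hsl : Integrable (fun x => s x * max (Real.log (s x)) 0) ν₁)
    (htl : Integrable (fun y => t y * max (Real.log (t y)) 0) ν₂) {a : ℝ} (ha : 0 ≤ a) :
    Integrable (fun z : α × β => a * (s z.1 * t z.2) * Real.log (a * (s z.1 * t z.2)))
      (ν₁.prod ν₂) := by
  have hdom := ((((hsl.mul_prod hti).add (hsi.mul_prod htl)).add
    ((hsi.mul_prod hti).const_mul (max (Real.log a) 0))).const_mul a).add
    (integrable_const (μ := ν₁.prod ν₂) (1 : ℝ))
  refine hdom.mono' (measurable_mul_log (((hs.comp measurable_fst).mul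
    (ht.comp measurable_snd)).const_mul a)).aestronglyMeasurable
    (Filter.Eventually.of_forall fun z => ?_)
  obtain ⟨x, y⟩ := z
  have hst : 0 ≤ s x * t y := mul_nonneg (hs0 x) (ht0 y)
  have hw : 0 ≤ a * (s x * t y) := mul_nonneg ha hst
  have hlog : Real.log (a * (s x * t y)) ≤
      max (Real.log a) 0 + (max (Real.log (s x)) 0 + max (Real.log (t y)) 0) := by
    have h1 := Real.posLog_mul (x := a) (y := s x * t y)
    have h2 := Real.posLog_mul (x := s x) (y := t y)
    simp only [Real.posLog_def, Pi.sup_apply, Pi.zero_apply] at h1 h2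
    rw [max_comm (Real.log a), max_comm (Real.log (s x)), max_comm (Real.log (t y))]
    linarith [le_max_right 0 (Real.log (a * (s x * t y)))]
  have hnn : 0 ≤ max (Real.log a) 0 + (max (Real.log (s x)) 0 + max (Real.log (t y)) 0) := by
    positivity
  have hup := mul_le_mul_of_nonneg_left hlog hw
  have hup0 := mul_nonneg hw hnn
  have hlow := neg_one_le_mul_log hw
  simp only [Pi.add_apply, Real.norm_eq_abs]
  rw [abs_le]
  constructor <;> nlinarith

section PrimalProblem

variable {n : ℕ} {Ω₁ Ω₂ : Set (Fin n → ℝ)} {μ₁ μ₂ : Measure (Fin n → ℝ)}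
  {c π : (Fin n → ℝ) × (Fin n → ℝ) → ℝ} {γ : ℝ}

lemma lintegral_neg_mul_log_lt_top {α : Type*} [MeasurableSpace α] {ν : Measure α}
    [IsFiniteMeasure ν] {p : α → ℝ} (hp0 : ∀ x, 0 ≤ p x) :
    ∫⁻ x, ENNReal.ofReal (-(p x * Real.log (p x))) ∂ν < ⊤ := by
  refine (lintegral_mono (g := fun _ => 1) fun x => ?_).trans_lt (by simp)
  rw [ENNReal.ofReal_le_one]
  linarith [neg_one_le_mul_log (hp0 x)]

lemma integrable_mul_log_iff {α : Type*} [MeasurableSpace α] {ν : Measure α}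
    [IsFiniteMeasure ν] {p : α → ℝ} (hp : Measurable p) (hp0 : ∀ x, 0 ≤ p x) :
    Integrable (fun x => p x * Real.log (p x)) ν ↔
      ∫⁻ x, ENNReal.ofReal (p x * Real.log (p x)) ∂ν < ⊤ := by
  refine ⟨fun h => (lintegral_ofReal_le_lintegral_enorm _).trans_lt h.2, fun h => ?_⟩
  refine ⟨(measurable_mul_log hp).aestronglyMeasurable, ?_⟩
  have hadd := ENNReal.add_lt_top.2 ⟨h, lintegral_neg_mul_log_lt_top (ν := ν) hp0⟩
  rw [← lintegral_add_left (measurable_mul_log hp).ennreal_ofReal] at hadd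
  refine (lintegral_mono fun x => ?_).trans_lt hadd
  rw [Real.enorm_eq_ofReal_abs, abs_eq_max_neg, ENNReal.ofReal_max]
  exact max_le le_self_add le_add_self

lemma primalValueEnt_of_integrable
    (h : Integrable (fun x => π x * Real.log (π x)) (volume.restrict (Ω₁ ×ˢ Ω₂))) :
    primalValueEnt Ω₁ Ω₂ c γ π = entropyCost (volume.restrict (Ω₁ ×ˢ Ω₂)) c γ π := by
  have h1 : ∫⁻ x in Ω₁ ×ˢ Ω₂, ENNReal.ofReal (π x * Real.log (π x)) ≠ ⊤ :=
    ((lintegral_ofReal_le_lintegral_enorm _).trans_lt h.2).ne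
  have h2 : ∫⁻ x in Ω₁ ×ˢ Ω₂, ENNReal.ofReal (-(π x * Real.log (π x))) ≠ ⊤ :=
    ((lintegral_ofReal_le_lintegral_enorm _).trans_lt h.neg.2).ne
  rw [primalValueEnt, entropyCost, integral_eq_lintegral_pos_part_sub_lintegral_neg_part h]
  lift ∫⁻ x in Ω₁ ×ˢ Ω₂, ENNReal.ofReal (π x * Real.log (π x)) to ℝ≥0 using h1 with a
  lift ∫⁻ x in Ω₁ ×ˢ Ω₂, ENNReal.ofReal (-(π x * Real.log (π x))) to ℝ≥0 using h2 with b
  rfl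

lemma primalValueEnt_eq_top (hγ : 0 < γ) [IsFiniteMeasure (volume.restrict (Ω₁ ×ˢ Ω₂))]
    (hπ : Measurable π) (hπ0 : ∀ x, 0 ≤ π x)
    (h : ¬Integrable (fun x => π x * Real.log (π x)) (volume.restrict (Ω₁ ×ˢ Ω₂))) :
    primalValueEnt Ω₁ Ω₂ c γ π = ⊤ := by
  rw [integrable_mul_log_iff hπ hπ0, not_lt, top_le_iff] at h
  have h2 := (lintegral_neg_mul_log_lt_top (ν := volume.restrict (Ω₁ ×ˢ Ω₂)) hπ0).ne
  rw [primalValueEnt, h]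
  lift ∫⁻ x in Ω₁ ×ˢ Ω₂, ENNReal.ofReal (-(π x * Real.log (π x))) to ℝ≥0 using h2 with r
  rw [EReal.coe_ennreal_top, EReal.coe_nnreal_eq_coe_real, EReal.top_sub_coe,
    EReal.coe_mul_top_of_pos hγ, EReal.coe_add_top]

lemma isFeasiblePlan_iff [IsFiniteMeasure μ₁] [IsFiniteMeasure μ₂] :
    IsFeasiblePlan Ω₁ Ω₂ μ₁ μ₂ π ↔ Measurable π ∧ (∀ x, 0 ≤ π x) ∧
      Integrable π (volume.restrict (Ω₁ ×ˢ Ω₂)) ∧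
      (∀ A, MeasurableSet A → ∫ x in Prod.fst ⁻¹' A, π x ∂volume.restrict (Ω₁ ×ˢ Ω₂) =
        μ₁.real A) ∧
      ∀ A, MeasurableSet A → ∫ x in Prod.snd ⁻¹' A, π x ∂volume.restrict (Ω₁ ×ˢ Ω₂) =
        μ₂.real A := by
  unfold IsFeasiblePlan
  constructor
  · rintro ⟨h1, h2, h3, h4⟩
    rw [map_withDensity_ofReal_eq_iff measurable_fst h1 h2] at h3
    rw [map_withDensity_ofReal_eq_iff measurable_snd h1 h2] at h4
    exact ⟨h1, h2, h3.1, h3.2, h4.2⟩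
  · rintro ⟨h1, h2, h3, h4, h5⟩
    exact ⟨h1, h2, (map_withDensity_ofReal_eq_iff measurable_fst h1 h2).2 ⟨h3, h4⟩,
      (map_withDensity_ofReal_eq_iff measurable_snd h1 h2).2 ⟨h3, h5⟩⟩

lemma IsFeasiblePlan.midpoint [IsFiniteMeasure μ₁] [IsFiniteMeasure μ₂]
    {π' : (Fin n → ℝ) × (Fin n → ℝ) → ℝ}
    (h : IsFeasiblePlan Ω₁ Ω₂ μ₁ μ₂ π) (h' : IsFeasiblePlan Ω₁ Ω₂ μ₁ μ₂ π') :
    IsFeasiblePlan Ω₁ Ω₂ μ₁ μ₂ fun x => (π x + π' x) / 2 := by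
  rw [isFeasiblePlan_iff] at *
  obtain ⟨h1, h2, h3, h4, h5⟩ := h
  obtain ⟨k1, k2, k3, k4, k5⟩ := h'
  refine ⟨(h1.add k1).div_const 2, fun x => by linarith [h2 x, k2 x], (h3.add k3).div_const 2,
    fun A hA => ?_, fun A hA => ?_⟩
  · rw [integral_div, integral_add h3.integrableOn k3.integrableOn, h4 A hA, k4 A hA]
    ring
  · rw [integral_div, integral_add h3.integrableOn k3.integrableOn, h5 A hA, k5 A hA]
    ring

lemma isFeasiblePlan_of_tendsto [IsFiniteMeasure μ₁] [IsFiniteMeasure μ₂]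
    {u : ℕ → (Fin n → ℝ) × (Fin n → ℝ) → ℝ} (hu : ∀ k, IsFeasiblePlan Ω₁ Ω₂ μ₁ μ₂ (u k))
    (hπ : Measurable π) (hπ0 : ∀ x, 0 ≤ π x)
    (hπi : Integrable π (volume.restrict (Ω₁ ×ˢ Ω₂)))
    (hlim : Filter.Tendsto (fun k => eLpNorm (u k - π) 1 (volume.restrict (Ω₁ ×ˢ Ω₂)))
      Filter.atTop (nhds 0)) :
    IsFeasiblePlan Ω₁ Ω₂ μ₁ μ₂ π := by
  simp only [isFeasiblePlan_iff] at *
  have hset := tendsto_setIntegral_of_L1' π hπi.aestronglyMeasurable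
    (Filter.Eventually.of_forall fun k => (hu k).2.2.1) hlim
  refine ⟨hπ, hπ0, hπi, fun A hA => ?_, fun A hA => ?_⟩
  · refine tendsto_nhds_unique (hset _) (tendsto_const_nhds.congr fun k => ?_)
    exact ((hu k).2.2.2.1 A hA).symm
  · refine tendsto_nhds_unique (hset _) (tendsto_const_nhds.congr fun k => ?_)
    exact ((hu k).2.2.2.2 A hA).symm

lemma volume_restrict_prod_eq (Ω₁ Ω₂ : Set (Fin n → ℝ)) :
    (volume : Measure ((Fin n → ℝ) × (Fin n → ℝ))).restrict (Ω₁ ×ˢ Ω₂) =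
      (volume.restrict Ω₁).prod (volume.restrict Ω₂) := by
  rw [Measure.prod_restrict, Measure.volume_eq_prod]

lemma IsFeasiblePlan.hasLLogLDensity [IsFiniteMeasure μ₁] [IsFiniteMeasure μ₂]
    [IsFiniteMeasure (volume.restrict Ω₁)] [IsFiniteMeasure (volume.restrict Ω₂)]
    (h : IsFeasiblePlan Ω₁ Ω₂ μ₁ μ₂ π)
    (hl : Integrable (fun x => π x * Real.log (π x)) (volume.restrict (Ω₁ ×ˢ Ω₂))) :
    HasLLogLDensity Ω₁ μ₁ ∧ HasLLogLDensity Ω₂ μ₂ := by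
  obtain ⟨h1, h2, h3, h4⟩ := h
  rw [volume_restrict_prod_eq] at h3 h4 hl
  rw [map_fst_prod_withDensity h1.ennreal_ofReal] at h3
  rw [map_snd_prod_withDensity h1.ennreal_ofReal] at h4
  rw [integrable_mul_log_iff h1 h2] at hl
  have hm := (measurable_mul_log h1).ennreal_ofReal.aemeasurable
    (μ := (volume.restrict Ω₁).prod (volume.restrict Ω₂))
  constructor
  · exact hasLLogLDensity_of_marginal (p := fun x y => π (x, y)) h1 (fun x y => h2 _) h3
      (by rwa [lintegral_prod _ hm] at hl)
  · exact hasLLogLDensity_of_marginal (p := fun y x => π (x, y)) (h1.comp measurable_swap)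
      (fun x y => h2 _) h4 (by rwa [lintegral_prod_symm _ hm] at hl)

lemma exists_isFeasiblePlan_of_hasLLogLDensity [IsFiniteMeasure μ₁] [IsFiniteMeasure μ₂]
    [IsFiniteMeasure (volume.restrict Ω₁)] [IsFiniteMeasure (volume.restrict Ω₂)]
    (hmass : μ₁ univ = μ₂ univ) (h₁ : HasLLogLDensity Ω₁ μ₁) (h₂ : HasLLogLDensity Ω₂ μ₂) :
    ∃ π, IsFeasiblePlan Ω₁ Ω₂ μ₁ μ₂ π ∧
      Integrable (fun x => π x * Real.log (π x)) (volume.restrict (Ω₁ ×ˢ Ω₂)) := by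
  obtain ⟨s, hs, hs0, hsμ, hsl⟩ := h₁
  obtain ⟨t, ht, ht0, htμ, htl⟩ := h₂
  have hsm : ∫⁻ x in Ω₁, ENNReal.ofReal (s x) = μ₁ univ := by
    rw [hsμ, withDensity_apply _ MeasurableSet.univ, Measure.restrict_univ]
  have htm : ∫⁻ x in Ω₂, ENNReal.ofReal (t x) = μ₁ univ := by
    rw [hmass, htμ, withDensity_apply _ MeasurableSet.univ, Measure.restrict_univ]
  have hfin : μ₁ univ ≠ ⊤ := measure_ne_top _ _
  have hsi : Integrable s (volume.restrict Ω₁) := ⟨hs.aestronglyMeasurable,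
    (hasFiniteIntegral_iff_ofReal (Filter.Eventually.of_forall hs0)).2
      (hsm ▸ measure_lt_top _ _)⟩
  have hti : Integrable t (volume.restrict Ω₂) := ⟨ht.aestronglyMeasurable,
    (hasFiniteIntegral_iff_ofReal (Filter.Eventually.of_forall ht0)).2
      (htm ▸ measure_lt_top _ _)⟩
  have ha : 0 ≤ (μ₁ univ).toReal⁻¹ := inv_nonneg.2 ENNReal.toReal_nonneg
  have hπm : Measurable fun z : (Fin n → ℝ) × (Fin n → ℝ) =>
      (μ₁ univ).toReal⁻¹ * (s z.1 * t z.2) :=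
    ((hs.comp measurable_fst).mul (ht.comp measurable_snd)).const_mul _
  refine ⟨_, ⟨hπm, fun z => mul_nonneg ha (mul_nonneg (hs0 _) (ht0 _)), ?_, ?_⟩, ?_⟩
  · rw [volume_restrict_prod_eq, map_fst_prod_withDensity hπm.ennreal_ofReal]
    simp only [ENNReal.ofReal_mul ha, ENNReal.ofReal_mul (hs0 _)]
    by_cases h0 : μ₁ univ = 0
    · simp [Measure.measure_univ_eq_zero.1 h0]
    · rw [ENNReal.ofReal_inv_of_pos (ENNReal.toReal_pos h0 hfin), ENNReal.ofReal_toReal hfin]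
      conv_rhs => rw [hsμ]
      congr 1 with x
      rw [lintegral_const_mul _ (ht.ennreal_ofReal.const_mul _),
        lintegral_const_mul _ ht.ennreal_ofReal, htm, mul_left_comm,
        ENNReal.inv_mul_cancel h0 hfin, mul_one]
  · rw [volume_restrict_prod_eq, map_snd_prod_withDensity hπm.ennreal_ofReal]
    simp only [ENNReal.ofReal_mul ha, ENNReal.ofReal_mul (hs0 _)]
    by_cases h0 : μ₁ univ = 0
    · simp [h0, Measure.measure_univ_eq_zero.1 (hmass ▸ h0)]
    · rw [ENNReal.ofReal_inv_of_pos (ENNReal.toReal_pos h0 hfin), ENNReal.ofReal_toReal hfin]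
      conv_rhs => rw [htμ]
      congr 1 with y
      rw [lintegral_const_mul _ (hs.ennreal_ofReal.mul_const _),
        lintegral_mul_const _ hs.ennreal_ofReal, hsm, ← mul_assoc,
        ENNReal.inv_mul_cancel h0 hfin, one_mul]
  · rw [volume_restrict_prod_eq]
    exact integrable_prod_mul_log hs ht hs0 ht0 hsi hti (integrable_mul_posLog hs hs0 hsl)
      (integrable_mul_posLog ht ht0 htl) ha

lemma IsEntMinimizer.integrable_mul_log (hγ : 0 < γ)
    [IsFiniteMeasure (volume.restrict (Ω₁ ×ˢ Ω₂))] (h : IsEntMinimizer Ω₁ Ω₂ μ₁ μ₂ c γ π) :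
    Integrable (fun x => π x * Real.log (π x)) (volume.restrict (Ω₁ ×ˢ Ω₂)) := by
  by_contra hl
  exact h.2.1 (primalValueEnt_eq_top hγ h.1.1 h.1.2.1 hl)

lemma isEntMinimizer_of_entropyCost_le (hγ : 0 < γ)
    [IsFiniteMeasure (volume.restrict (Ω₁ ×ˢ Ω₂))] (hπ : IsFeasiblePlan Ω₁ Ω₂ μ₁ μ₂ π)
    (hl : Integrable (fun x => π x * Real.log (π x)) (volume.restrict (Ω₁ ×ˢ Ω₂)))
    (hmin : ∀ π', IsFeasiblePlan Ω₁ Ω₂ μ₁ μ₂ π' →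
      Integrable (fun x => π' x * Real.log (π' x)) (volume.restrict (Ω₁ ×ˢ Ω₂)) →
      entropyCost (volume.restrict (Ω₁ ×ˢ Ω₂)) c γ π ≤
        entropyCost (volume.restrict (Ω₁ ×ˢ Ω₂)) c γ π') :
    IsEntMinimizer Ω₁ Ω₂ μ₁ μ₂ c γ π := by
  refine ⟨hπ, by simp [primalValueEnt_of_integrable hl], fun π' hπ' => ?_⟩
  by_cases hl' : Integrable (fun x => π' x * Real.log (π' x)) (volume.restrict (Ω₁ ×ˢ Ω₂))
  · rw [primalValueEnt_of_integrable hl, primalValueEnt_of_integrable hl', EReal.coe_le_coe_iff]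
    exact hmin π' hπ' hl'
  · rw [primalValueEnt_eq_top hγ hπ'.1 hπ'.2.1 hl']
    exact le_top

lemma IsEntMinimizer.entropyCost_le {π' : (Fin n → ℝ) × (Fin n → ℝ) → ℝ} (hγ : 0 < γ)
    [IsFiniteMeasure (volume.restrict (Ω₁ ×ˢ Ω₂))] (h : IsEntMinimizer Ω₁ Ω₂ μ₁ μ₂ c γ π)
    (hπ' : IsFeasiblePlan Ω₁ Ω₂ μ₁ μ₂ π')
    (hl' : Integrable (fun x => π' x * Real.log (π' x)) (volume.restrict (Ω₁ ×ˢ Ω₂))) :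
    entropyCost (volume.restrict (Ω₁ ×ˢ Ω₂)) c γ π ≤
      entropyCost (volume.restrict (Ω₁ ×ˢ Ω₂)) c γ π' := by
  have := h.2.2 π' hπ'
  rwa [primalValueEnt_of_integrable (h.integrable_mul_log hγ), primalValueEnt_of_integrable hl',
    EReal.coe_le_coe_iff] at this

end PrimalProblem

/-- The entropically regularized transport problem admits a minimizer with finite value iff
both marginals have Lebesgue densities `σᵢ` with `∫ σᵢ log₊ σᵢ < ∞`; in that case the
minimizer satisfies `∫ π̄ log₊ π̄ < ∞` and is unique (up to a.e. equality). -/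
theorem ent_primal_existence {n : ℕ}
    (Ω₁ Ω₂ : Set (Fin n → ℝ)) (hΩ₁ : IsCompact Ω₁) (hΩ₂ : IsCompact Ω₂)
    (μ₁ μ₂ : Measure (Fin n → ℝ)) [IsFiniteMeasure μ₁] [IsFiniteMeasure μ₂]
    (hμ₁ : μ₁ Ω₁ᶜ = 0) (hμ₂ : μ₂ Ω₂ᶜ = 0) (hmass : μ₁ Ω₁ = μ₂ Ω₂)
    (c : (Fin n → ℝ) × (Fin n → ℝ) → ℝ) (hc : ContinuousOn c (Ω₁ ×ˢ Ω₂))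
    (γ : ℝ) (hγ : 0 < γ) :
    ((∃ π, IsEntMinimizer Ω₁ Ω₂ μ₁ μ₂ c γ π) ↔
      (HasLLogLDensity Ω₁ μ₁ ∧ HasLLogLDensity Ω₂ μ₂)) ∧
    (∀ π, IsEntMinimizer Ω₁ Ω₂ μ₁ μ₂ c γ π →
      ∫⁻ x in Ω₁ ×ˢ Ω₂, ENNReal.ofReal (π x * max (Real.log (π x)) 0) < ⊤) ∧
    (∀ π π', IsEntMinimizer Ω₁ Ω₂ μ₁ μ₂ c γ π → IsEntMinimizer Ω₁ Ω₂ μ₁ μ₂ c γ π' →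
      π =ᵐ[volume.restrict (Ω₁ ×ˢ Ω₂)] π') := by
  have hΩ := hΩ₁.prod hΩ₂
  have : IsFiniteMeasure (volume.restrict Ω₁) :=
    isFiniteMeasure_restrict.2 hΩ₁.measure_lt_top.ne
  have : IsFiniteMeasure (volume.restrict Ω₂) :=
    isFiniteMeasure_restrict.2 hΩ₂.measure_lt_top.ne
  have : IsFiniteMeasure (volume.restrict (Ω₁ ×ˢ Ω₂)) :=
    isFiniteMeasure_restrict.2 hΩ.measure_lt_top.ne
  have hcm : AEStronglyMeasurable c (volume.restrict (Ω₁ ×ˢ Ω₂)) :=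
    hc.aestronglyMeasurable hΩ.measurableSet
  obtain ⟨C, hC⟩ := hΩ.exists_bound_of_continuousOn hc
  have hCae : ∀ᵐ x ∂volume.restrict (Ω₁ ×ˢ Ω₂), ‖c x‖ ≤ C :=
    (ae_restrict_iff' hΩ.measurableSet).2 (Filter.Eventually.of_forall hC)
  have hmass' : μ₁ univ = μ₂ univ := by
    rw [← measure_add_measure_compl hΩ₁.measurableSet, hμ₁,
      ← measure_add_measure_compl hΩ₂.measurableSet, hμ₂, hmass]
  refine ⟨⟨?_, ?_⟩, ?_, ?_⟩
  · rintro ⟨π, h⟩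
    exact h.1.hasLLogLDensity (h.integrable_mul_log hγ)
  · rintro ⟨h₁, h₂⟩
    obtain ⟨π, hπ, hl, hmin⟩ := exists_entropyCost_minimizer hγ hcm hCae
      (K := {π | IsFeasiblePlan Ω₁ Ω₂ μ₁ μ₂ π}) (M := μ₁.real univ)
      (fun p hp => by
        obtain ⟨hp1, hp2, hp3, hp4, -⟩ := isFeasiblePlan_iff.1 hp
        exact ⟨hp1, hp2, hp3, by simpa using hp4 univ MeasurableSet.univ⟩)
      (fun p hp q hq => IsFeasiblePlan.midpoint hp hq)
      (fun u p hu hp hp0 hpi hlim => isFeasiblePlan_of_tendsto hu hp hp0 hpi hlim)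
      (exists_isFeasiblePlan_of_hasLLogLDensity hmass' h₁ h₂)
    exact ⟨π, isEntMinimizer_of_entropyCost_le hγ hπ hl hmin⟩
  · intro π h
    simp only [ofReal_mul_posLog (h.1.2.1 _)]
    exact (integrable_mul_log_iff h.1.1 h.1.2.1).1 (h.integrable_mul_log hγ)
  · intro π π' h h'
    have hl := h.integrable_mul_log hγ
    have hl' := h'.integrable_mul_log hγ
    have hmid := h.1.midpoint h'.1
    have hmidl := integrable_midpoint_mul_log h.1.1 h'.1.1 h.1.2.1 h'.1.2.1 hl hl'
    exact entropyCost_minimizer_unique hγ hcm hCae h.1.1 h'.1.1 h.1.2.1 h'.1.2.1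
      (isFeasiblePlan_iff.1 h.1).2.2.1 (isFeasiblePlan_iff.1 h'.1).2.2.1 hl hl'
      (h.entropyCost_le hγ hmid hmidl) (h'.entropyCost_le hγ hmid hmidl)
end
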